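/- arXiv:math/0604061 — 2 statements merged into one kernel-verified Lean document; each statement's English description precedes it below -/
import Mathlib

section
/- Let G be a Garside group with Garside element Δ, set 𝒟 of simple elements, and N = ‖Δ‖. If g is a non-identity element of G, then t_𝒟(g) ≥ 1/N. -/
open Filter Topology Pointwise

/-- Left divisibility order on a group relative to a submonoid `P` of positive elements:
`a ≤_L b` iff `a⁻¹ * b ∈ P`. -/
def leL {G : Type*} [Group G] (P : Submonoid G) (a b : G) : Prop := a⁻¹ * b ∈ P

/-- Right divisibility order: `a ≤_R b` iff `b * a⁻¹ ∈ P`. -/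
def leR {G : Type*} [Group G] (P : Submonoid G) (a b : G) : Prop := b * a⁻¹ ∈ P

/-- An atom of the positive monoid `P`: a nontrivial element admitting no nontrivial
factorization inside `P`. -/
def IsMonAtom {G : Type*} [Group G] (P : Submonoid G) (a : G) : Prop :=
  a ∈ P ∧ a ≠ 1 ∧ ∀ b c : G, b ∈ P → c ∈ P → a = b * c → b = 1 ∨ c = 1

/-- `a` can be written as a product of `n` atoms of `P`. -/
def IsAtomProd {G : Type*} [Group G] (P : Submonoid G) (n : ℕ) (a : G) : Prop :=
  ∃ l : List G, l.length = n ∧ (∀ x ∈ l, IsMonAtom P x) ∧ l.prod = a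

/-- A Garside structure on a group `G`: `G` is the group of fractions of the positive
monoid `P`, which is a finitely generated atomic monoid (with atomic norm `norm`),
a lattice for both `≤_L` and `≤_R`, equipped with a Garside element `Δ` whose left and
right divisors coincide and generate `P`.  The fields `zinf`, `zsup`, `infs`, `sups`,
`tinf`, `tsup` are the (uniquely determined) invariants
`inf g = max {r : Δ^r ≤_L g}`, `sup g = min {s : g ≤_L Δ^s}`,
`inf_s g = max {inf h : h ∈ [g]}`, `sup_s g = min {sup h : h ∈ [g]}`,
`t_inf g = lim inf(gⁿ)/n` and `t_sup g = lim sup(gⁿ)/n`,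
each given together with its defining specification. -/
structure GarsideGroup (G : Type*) [Group G] where
  P : Submonoid G
  /-- `G` is the group of fractions of `P`. -/
  fraction : ∀ g : G, ∃ a b : G, a ∈ P ∧ b ∈ P ∧ g = a⁻¹ * b
  /-- `P` is finitely generated. -/
  fg : P.FG
  /-- the atomic norm `‖·‖` -/
  norm : G → ℕ
  /-- `P` is atomic: every positive element is a product of atoms and `norm a` is the
  greatest length of such an expression. -/
  norm_spec : ∀ a ∈ P, IsGreatest {n : ℕ | IsAtomProd P n a} (norm a)
  /-- `(P, ≤_L)` is a lattice: gcd's and lcm's exist. -/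
  latticeL : ∀ a ∈ P, ∀ b ∈ P,
    (∃ c ∈ P, leL P c a ∧ leL P c b ∧ ∀ d ∈ P, leL P d a → leL P d b → leL P d c) ∧
    (∃ c ∈ P, leL P a c ∧ leL P b c ∧ ∀ d ∈ P, leL P a d → leL P b d → leL P c d)
  /-- `(P, ≤_R)` is a lattice. -/
  latticeR : ∀ a ∈ P, ∀ b ∈ P,
    (∃ c ∈ P, leR P c a ∧ leR P c b ∧ ∀ d ∈ P, leR P d a → leR P d b → leR P d c) ∧
    (∃ c ∈ P, leR P a c ∧ leR P b c ∧ ∀ d ∈ P, leR P a d → leR P b d → leR P c d)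
  /-- the Garside element -/
  Δ : G
  Δ_mem : Δ ∈ P
  /-- the left and right divisors of `Δ` coincide -/
  Δ_balanced : ∀ a ∈ P, (leL P a Δ ↔ leR P a Δ)
  /-- the simple elements generate `P` -/
  simples_gen : Submonoid.closure {a : G | a ∈ P ∧ leL P a Δ} = P
  /-- `inf g = max {r : ℤ | Δ^r ≤_L g}` -/
  zinf : G → ℤ
  /-- `sup g = min {s : ℤ | g ≤_L Δ^s}` -/
  zsup : G → ℤ
  zinf_spec : ∀ g : G, IsGreatest {r : ℤ | leL P (Δ ^ r) g} (zinf g)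
  zsup_spec : ∀ g : G, IsLeast {s : ℤ | leL P g (Δ ^ s)} (zsup g)
  /-- `inf_s g = max {inf h : h ∈ [g]}` -/
  infs : G → ℤ
  /-- `sup_s g = min {sup h : h ∈ [g]}` -/
  sups : G → ℤ
  infs_spec : ∀ g : G, IsGreatest (Set.range fun h : G => zinf (h⁻¹ * g * h)) (infs g)
  sups_spec : ∀ g : G, IsLeast (Set.range fun h : G => zsup (h⁻¹ * g * h)) (sups g)
  /-- `t_inf g = lim_{n → ∞} inf(gⁿ)/n` -/
  tinf : G → ℝ
  /-- `t_sup g = lim_{n → ∞} sup(gⁿ)/n` -/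
  tsup : G → ℝ
  tinf_spec : ∀ g : G,
    Filter.Tendsto (fun n : ℕ => (zinf (g ^ n) : ℝ) / (n : ℝ)) Filter.atTop (nhds (tinf g))
  tsup_spec : ∀ g : G,
    Filter.Tendsto (fun n : ℕ => (zsup (g ^ n) : ℝ) / (n : ℝ)) Filter.atTop (nhds (tsup g))

namespace GarsideGroup

variable {G : Type*} [Group G] (Γ : GarsideGroup G)

/-- The set `𝒟` of simple elements. -/
def simples : Set G := {a : G | a ∈ Γ.P ∧ leL Γ.P a Γ.Δ}

/-- `len g = sup g - inf g` -/
def len (g : G) : ℤ := Γ.zsup g - Γ.zinf g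

/-- `t_len g = t_sup g - t_inf g` -/
noncomputable def tlen (g : G) : ℝ := Γ.tsup g - Γ.tinf g

/-- `g` is inf-straight if `inf g = t_inf g`. -/
def InfStraight (g : G) : Prop := (Γ.zinf g : ℝ) = Γ.tinf g

/-- `g` is sup-straight if `sup g = t_sup g`. -/
def SupStraight (g : G) : Prop := (Γ.zsup g : ℝ) = Γ.tsup g

/-- The super summit set `[g]^S`. -/
def superSummit (g : G) : Set G :=
  {h : G | (∃ x : G, x⁻¹ * g * x = h) ∧ Γ.zinf h = Γ.infs g ∧ Γ.zsup h = Γ.sups g}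

end GarsideGroup

/-- The shortest length of a word over the alphabet `X` representing `g`. -/
noncomputable def wlen {G : Type*} [Group G] (X : Set G) (g : G) : ℕ :=
  sInf {n : ℕ | ∃ l : List G, l.length = n ∧ (∀ x ∈ l, x ∈ X) ∧ l.prod = g}


section helpers

variable {G : Type*} [Group G]

theorem leL_refl' (P : Submonoid G) (a : G) : leL P a a := by
  simp [leL, P.one_mem]

theorem leL_trans' {P : Submonoid G} {a b c : G} (h : leL P a b) (h' : leL P b c) :
    leL P a c := by
  have := P.mul_mem h h'
  unfold leL
  convert this using 1
  group

theorem leL_left (P : Submonoid G) (g a b : G) : leL P (g * a) (g * b) ↔ leL P a b := by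
  unfold leL
  have : (g * a)⁻¹ * (g * b) = a⁻¹ * b := by group
  rw [this]

namespace GarsideGroup

variable (Γ : GarsideGroup G)

theorem norm_mul {a b : G} (ha : a ∈ Γ.P) (hb : b ∈ Γ.P) :
    Γ.norm a + Γ.norm b ≤ Γ.norm (a * b) := by
  obtain ⟨l, hl, hl', hl''⟩ := (Γ.norm_spec a ha).1
  obtain ⟨k, hk, hk', hk''⟩ := (Γ.norm_spec b hb).1
  apply (Γ.norm_spec (a * b) (Γ.P.mul_mem ha hb)).2
  refine ⟨l ++ k, by simp [hl, hk], ?_, by simp [hl'', hk'']⟩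
  intro x hx
  rcases List.mem_append.1 hx with h | h
  · exact hl' x h
  · exact hk' x h

theorem eq_one_of_norm {a : G} (ha : a ∈ Γ.P) (h : Γ.norm a = 0) : a = 1 := by
  obtain ⟨l, hl, hl', hl''⟩ := (Γ.norm_spec a ha).1
  rw [h] at hl
  rw [List.length_eq_zero_iff] at hl
  subst hl
  simpa using hl''.symm

theorem norm_one' : Γ.norm 1 = 0 := by
  have := Γ.norm_mul Γ.P.one_mem Γ.P.one_mem
  simp at this
  exact this

theorem norm_pow_ge {a : G} (ha : a ∈ Γ.P) (n : ℕ) : n * Γ.norm a ≤ Γ.norm (a ^ n) := by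
  induction n with
  | zero => simp
  | succ n ih =>
    have := Γ.norm_mul (Γ.P.pow_mem ha n) ha
    rw [pow_succ]
    nlinarith

theorem eq_one_of_inv {a : G} (ha : a ∈ Γ.P) (ha' : a⁻¹ ∈ Γ.P) : a = 1 := by
  have := Γ.norm_mul ha ha'
  rw [mul_inv_cancel, Γ.norm_one'] at this
  exact Γ.eq_one_of_norm ha (by omega)

theorem antisymm' {a b : G} (h : leL Γ.P a b) (h' : leL Γ.P b a) : a = b := by
  have h2 : (a⁻¹ * b)⁻¹ ∈ Γ.P := by
    unfold leL at h'
    convert h' using 1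
    group
  have := Γ.eq_one_of_inv h h2
  rw [inv_mul_eq_one] at this
  exact this

theorem Δ_inv_not_mem : Γ.Δ⁻¹ ∉ Γ.P := by
  intro h
  have h1 := Γ.eq_one_of_inv Γ.Δ_mem h
  have h2 := (Γ.zinf_spec 1).2 (show Γ.zinf 1 + 1 ∈ _ by simp [leL, h1, Γ.P.one_mem])
  omega

theorem norm_Δ_pos : 0 < Γ.norm Γ.Δ := by
  rcases Nat.eq_zero_or_pos (Γ.norm Γ.Δ) with h | h
  · exfalso
    apply Γ.Δ_inv_not_mem
    rw [Γ.eq_one_of_norm Γ.Δ_mem h]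
    simp [Γ.P.one_mem]
  · exact h

theorem conj1 {a : G} (ha : a ∈ Γ.P) : Γ.Δ⁻¹ * a * Γ.Δ ∈ Γ.P := by
  rw [← Γ.simples_gen] at ha
  induction ha using Submonoid.closure_induction with
  | mem a h =>
    obtain ⟨h1, h2⟩ := h
    have h3 : leL Γ.P (a⁻¹ * Γ.Δ) Γ.Δ := by
      rw [Γ.Δ_balanced _ h2]
      unfold leR
      convert h1 using 1
      group
    unfold leL at h3
    convert h3 using 1
    group
  | one => simp [Γ.P.one_mem]
  | mul x y _ _ hx hy =>
    convert Γ.P.mul_mem hx hy using 1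
    group

theorem conj2 {a : G} (ha : a ∈ Γ.P) : Γ.Δ * a * Γ.Δ⁻¹ ∈ Γ.P := by
  rw [← Γ.simples_gen] at ha
  induction ha using Submonoid.closure_induction with
  | mem a h =>
    obtain ⟨h1, h2⟩ := h
    have h4 : leR Γ.P a Γ.Δ := (Γ.Δ_balanced _ h1).1 h2
    have h3 : leR Γ.P (Γ.Δ * a⁻¹) Γ.Δ := by
      rw [← Γ.Δ_balanced _ h4]
      unfold leL
      convert h1 using 1
      group
    unfold leR at h3
    convert h3 using 1
    group
  | one => simp [Γ.P.one_mem]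
  | mul x y _ _ hx hy =>
    convert Γ.P.mul_mem hx hy using 1
    group

theorem conjp1 {a : G} (ha : a ∈ Γ.P) (k : ℕ) : (Γ.Δ ^ k)⁻¹ * a * Γ.Δ ^ k ∈ Γ.P := by
  induction k with
  | zero => simpa using ha
  | succ k ih =>
    convert Γ.conj1 ih using 1
    rw [pow_succ]
    group

theorem conjp2 {a : G} (ha : a ∈ Γ.P) (k : ℕ) : Γ.Δ ^ k * a * (Γ.Δ ^ k)⁻¹ ∈ Γ.P := by
  induction k with
  | zero => simpa using ha
  | succ k ih =>
    convert Γ.conj2 ih using 1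
    rw [pow_succ']
    group

theorem leL_right (k : ℕ) (a b : G) :
    leL Γ.P (a * Γ.Δ ^ k) (b * Γ.Δ ^ k) ↔ leL Γ.P a b := by
  unfold leL
  constructor
  · intro h
    convert Γ.conjp2 h k using 1
    group
  · intro h
    convert Γ.conjp1 h k using 1
    group

theorem word_lower (l : List G) (hl : ∀ x ∈ l, x ∈ Γ.simples ∪ Γ.simples⁻¹) :
    Γ.Δ ^ l.length * l.prod ∈ Γ.P := by
  induction l with
  | nil => simp [Γ.P.one_mem]
  | cons x l ih =>
    have ih := ih (fun y hy => hl y (List.mem_cons_of_mem _ hy))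
    have hx : Γ.Δ * x ∈ Γ.P := by
      rcases hl x List.mem_cons_self with h | h
      · exact Γ.P.mul_mem Γ.Δ_mem h.1
      · have h' : x⁻¹ ∈ Γ.simples := h
        have := (Γ.Δ_balanced _ h'.1).1 h'.2
        unfold leR at this
        simpa using this
    convert Γ.P.mul_mem (Γ.conjp2 hx l.length) ih using 1
    rw [List.length_cons, List.prod_cons, pow_succ]
    group

theorem exists_word_pos {a : G} (ha : a ∈ Γ.P) :
    ∃ l : List G, (∀ x ∈ l, x ∈ Γ.simples) ∧ l.prod = a := by
  rw [← Γ.simples_gen] at ha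
  exact Submonoid.exists_list_of_mem_closure ha

theorem word_inv {l : List G} (hl : ∀ x ∈ l, x ∈ Γ.simples ∪ Γ.simples⁻¹) :
    ∀ x ∈ (l.map (·⁻¹)).reverse, x ∈ Γ.simples ∪ Γ.simples⁻¹ := by
  intro x hx
  simp only [List.mem_reverse, List.mem_map] at hx
  obtain ⟨y, hy, rfl⟩ := hx
  rcases hl y hy with h | h
  · right; simpa using h
  · left; exact h

theorem exists_word (g : G) :
    ∃ l : List G, (∀ x ∈ l, x ∈ Γ.simples ∪ Γ.simples⁻¹) ∧ l.prod = g := by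
  obtain ⟨a, b, ha, hb, rfl⟩ := Γ.fraction g
  obtain ⟨l, hl, rfl⟩ := Γ.exists_word_pos ha
  obtain ⟨k, hk, rfl⟩ := Γ.exists_word_pos hb
  refine ⟨(l.map (·⁻¹)).reverse ++ k, ?_, by rw [List.prod_append, List.prod_inv_reverse]⟩
  intro x hx
  rcases List.mem_append.1 hx with h | h
  · exact Γ.word_inv (fun x hx => Or.inl (hl x hx)) x h
  · exact Or.inl (hk x h)

/-- word length with respect to simples and inverses -/
noncomputable abbrev wl (g : G) : ℕ := wlen (Γ.simples ∪ Γ.simples⁻¹) g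

theorem wl_spec (g : G) : ∃ l : List G, l.length = Γ.wl g ∧
    (∀ x ∈ l, x ∈ Γ.simples ∪ Γ.simples⁻¹) ∧ l.prod = g := by
  obtain ⟨l, h1, h2⟩ := Γ.exists_word g
  exact Nat.sInf_mem (s := {n : ℕ | ∃ l : List G, l.length = n ∧
    (∀ x ∈ l, x ∈ Γ.simples ∪ Γ.simples⁻¹) ∧ l.prod = g}) ⟨l.length, l, rfl, h1, h2⟩

theorem wl_le {g : G} {l : List G} (hl : ∀ x ∈ l, x ∈ Γ.simples ∪ Γ.simples⁻¹)
    (h : l.prod = g) : Γ.wl g ≤ l.length :=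
  Nat.sInf_le ⟨l, rfl, hl, h⟩

theorem wl_mul (g h : G) : Γ.wl (g * h) ≤ Γ.wl g + Γ.wl h := by
  obtain ⟨l, h1, h2, h3⟩ := Γ.wl_spec g
  obtain ⟨k, h4, h5, h6⟩ := Γ.wl_spec h
  rw [← h1, ← h4, ← List.length_append]
  apply Γ.wl_le
  · intro x hx
    rcases List.mem_append.1 hx with h | h
    · exact h2 x h
    · exact h5 x h
  · rw [List.prod_append, h3, h6]

theorem wl_inv_le (g : G) : Γ.wl g⁻¹ ≤ Γ.wl g := by
  obtain ⟨l, h1, h2, h3⟩ := Γ.wl_spec g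
  rw [← h1]
  have := Γ.wl_le (Γ.word_inv h2) (g := g⁻¹) (by rw [← List.prod_inv_reverse, h3])
  simpa using this

theorem wl_lower (g : G) : Γ.Δ ^ Γ.wl g * g ∈ Γ.P := by
  obtain ⟨l, h1, h2, h3⟩ := Γ.wl_spec g
  have := Γ.word_lower l h2
  rwa [h1, h3] at this

theorem lower_mono {g : G} {k m : ℕ} (h : Γ.Δ ^ k * g ∈ Γ.P) (hkm : k ≤ m) :
    Γ.Δ ^ m * g ∈ Γ.P := by
  obtain ⟨j, rfl⟩ := Nat.exists_eq_add_of_le hkm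
  rw [add_comm, pow_add, mul_assoc]
  exact Γ.P.mul_mem (Γ.P.pow_mem Γ.Δ_mem j) h

theorem exists_join (a b : G) : ∃ c, leL Γ.P a c ∧ leL Γ.P b c ∧
    ∀ d, leL Γ.P a d → leL Γ.P b d → leL Γ.P c d := by
  set k := max (Γ.wl a) (Γ.wl b)
  have ha := Γ.lower_mono (Γ.wl_lower a) (le_max_left _ (Γ.wl b))
  have hb := Γ.lower_mono (Γ.wl_lower b) (le_max_right (Γ.wl a) _)
  obtain ⟨c, hc, h1, h2, h3⟩ := (Γ.latticeL _ ha _ hb).2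
  refine ⟨(Γ.Δ ^ k)⁻¹ * c, ?_, ?_, ?_⟩
  · rw [← leL_left _ (Γ.Δ ^ k)]; simpa using h1
  · rw [← leL_left _ (Γ.Δ ^ k)]; simpa using h2
  · intro d h4 h5
    rw [← leL_left _ (Γ.Δ ^ k)] at h4 h5 ⊢
    rw [mul_inv_cancel_left]
    refine h3 _ ?_ h4 h5
    have := Γ.P.mul_mem ha h4
    rwa [mul_inv_cancel_left] at this

theorem exists_glb (F : Set G) {f0 : G} (hf0 : f0 ∈ F) {x0 : G}
    (hx0 : ∀ y ∈ F, leL Γ.P x0 y) :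
    ∃ x, (∀ y ∈ F, leL Γ.P x y) ∧ ∀ z, (∀ y ∈ F, leL Γ.P z y) → leL Γ.P z x := by
  classical
  let S : Set ℕ := {n | ∃ x, (∀ y ∈ F, leL Γ.P x y) ∧ leL Γ.P x0 x ∧ Γ.norm (x0⁻¹ * x) = n}
  have hne : S.Nonempty := ⟨_, x0, hx0, leL_refl' _ _, rfl⟩
  have hbd : BddAbove S := by
    refine ⟨Γ.norm (x0⁻¹ * f0), ?_⟩
    rintro n ⟨x, h1, h2, rfl⟩
    have := Γ.norm_mul h2 (h1 f0 hf0)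
    rw [show x0⁻¹ * x * (x⁻¹ * f0) = x0⁻¹ * f0 by group] at this
    omega
  obtain ⟨x, h1, h2, h3⟩ := Nat.sSup_mem hne hbd
  refine ⟨x, h1, fun z hz => ?_⟩
  obtain ⟨c, h4, h5, h6⟩ := Γ.exists_join x z
  have hc : Γ.norm (x0⁻¹ * c) ≤ sSup S :=
    le_csSup hbd ⟨c, fun y hy => h6 y (h1 y hy) (hz y hy), leL_trans' h2 h4, rfl⟩
  have := Γ.norm_mul h2 h4
  rw [show x0⁻¹ * x * (x⁻¹ * c) = x0⁻¹ * c by group] at this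
  have h7 := Γ.eq_one_of_norm h4 (by omega)
  rw [inv_mul_eq_one] at h7
  rwa [h7]

theorem key (g : G) (α : ℝ) (hα : α * Γ.norm Γ.Δ < 1) (hα0 : 0 ≤ α) (C : ℕ)
    (hC : ∀ n m : ℕ, α * n ≤ m → leL Γ.P (Γ.Δ ^ C)⁻¹ (g ^ n * Γ.Δ ^ m)) :
    ∃ y, y⁻¹ * g * y ∈ Γ.P := by
  set N := Γ.norm Γ.Δ with hN
  -- step 1
  obtain ⟨x, hx1, hx2⟩ := Γ.exists_glb {h | ∃ n m : ℕ, α * n ≤ m ∧ h = g ^ n * Γ.Δ ^ m}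
    (f0 := 1) ⟨0, 0, by simp, by simp⟩ (x0 := (Γ.Δ ^ C)⁻¹)
    (by rintro y ⟨n, m, h, rfl⟩; exact hC n m h)
  have hx : ∀ n m : ℕ, α * n ≤ m → leL Γ.P x (g ^ n * x * Γ.Δ ^ m) := by
    intro n m h
    have : leL Γ.P ((g ^ n)⁻¹ * x * (Γ.Δ ^ m)⁻¹) x := by
      apply hx2
      rintro y ⟨n', m', h', rfl⟩
      rw [← Γ.leL_right m, ← leL_left _ (g ^ n)]
      have := hx1 (g ^ (n + n') * Γ.Δ ^ (m' + m)) ⟨n + n', m' + m, by push_cast; linarith, rfl⟩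
      convert this using 1
      · group
      · simp only [pow_add, mul_assoc]
    rw [← Γ.leL_right m, ← leL_left _ (g ^ n)] at this
    convert this using 1
    · group
    · group
  have hx' : ∀ n m : ℕ, α * n ≤ m → leL Γ.P (x * (Γ.Δ ^ m)⁻¹) (g ^ n * x) := by
    intro n m h
    rw [← Γ.leL_right m]
    convert hx n m h using 1
    group
  have hx1' : ∀ n ≤ N, leL Γ.P (x * Γ.Δ⁻¹) (g ^ n * x) := by
    intro n hn
    have := hx' n 1 (by
      have : (n : ℝ) ≤ N := by exact_mod_cast hn
      push_cast
      nlinarith)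
    simpa using this
  -- step 2
  by_contra hcon
  push Not at hcon
  have hy : ∀ k ≤ N, ∃ y, (∀ i ≤ k, leL Γ.P y (g ^ i * x)) ∧
      (∀ z, (∀ i ≤ k, leL Γ.P z (g ^ i * x)) → leL Γ.P z y) ∧ leL Γ.P (x * Γ.Δ⁻¹) y ∧
      Γ.norm ((x * Γ.Δ⁻¹)⁻¹ * y) + k ≤ N := by
    intro k
    induction k with
    | zero =>
      intro _
      refine ⟨x, ?_, ?_, ?_, ?_⟩
      · intro i hi
        obtain rfl : i = 0 := by omega
        simpa using leL_refl' _ _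
      · intro z hz
        simpa using hz 0 le_rfl
      · simpa using hx1' 0 (by omega)
      · rw [show (x * Γ.Δ⁻¹)⁻¹ * x = Γ.Δ by group]
        omega
    | succ k ih =>
      intro hk
      obtain ⟨y, h1, h2, h3, h4⟩ := ih (by omega)
      obtain ⟨w, hw1, hw2⟩ := Γ.exists_glb {h | ∃ i ≤ k + 1, h = g ^ i * x}
        (f0 := x) ⟨0, by omega, by simp⟩ (x0 := x * Γ.Δ⁻¹)
        (by rintro y ⟨n, h, rfl⟩; exact hx1' n (by omega))
      have hw1' : ∀ i ≤ k + 1, leL Γ.P w (g ^ i * x) := fun i hi => hw1 _ ⟨i, hi, rfl⟩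
      have hwy : leL Γ.P w y := h2 w fun i hi => hw1' i (by omega)
      have hxw : leL Γ.P (x * Γ.Δ⁻¹) w := by
        apply hw2
        rintro y ⟨n, h, rfl⟩; exact hx1' n (by omega)
      refine ⟨w, hw1', ?_, hxw, ?_⟩
      · intro z hz
        apply hw2
        rintro y ⟨n, h, rfl⟩; exact hz n h
      · have h5 := Γ.norm_mul hxw hwy
        rw [show (x * Γ.Δ⁻¹)⁻¹ * w * (w⁻¹ * y) = (x * Γ.Δ⁻¹)⁻¹ * y by group] at h5
        have h6 : Γ.norm (w⁻¹ * y) ≠ 0 := by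
          intro h0
          have h7 := Γ.eq_one_of_norm hwy h0
          rw [inv_mul_eq_one] at h7
          subst h7
          apply hcon w
          have : leL Γ.P (g⁻¹ * w) w := by
            apply h2
            intro i hi
            rw [← leL_left _ g, mul_inv_cancel_left, ← mul_assoc, ← pow_succ']
            exact hw1' _ (by omega)
          rw [← leL_left _ g, mul_inv_cancel_left] at this
          unfold leL at this
          rwa [mul_assoc]
        omega
  obtain ⟨y, -, h2, h3, h4⟩ := hy N le_rfl
  have h5 := Γ.eq_one_of_norm h3 (by omega)
  rw [inv_mul_eq_one] at h5
  subst h5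
  have hz : ∀ k : ℕ, ∀ z, (∀ i ≤ k * N, leL Γ.P z (g ^ i * x)) →
      leL Γ.P z (x * (Γ.Δ ^ k)⁻¹) := by
    intro k
    induction k with
    | zero => intro z hz; simpa using hz 0 (by omega)
    | succ k ih =>
      intro z hz
      have : leL Γ.P (z * Γ.Δ ^ k) (x * Γ.Δ⁻¹) := by
        apply h2
        intro j hj
        have := ih ((g ^ j)⁻¹ * z) (by
          intro i hi
          rw [← leL_left _ (g ^ j), mul_inv_cancel_left, ← mul_assoc, ← pow_add]
          apply hz
          rw [Nat.succ_mul]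
          omega)
        rw [← leL_left _ (g ^ j), mul_inv_cancel_left, ← Γ.leL_right k] at this
        convert this using 1
        group
      rw [← Γ.leL_right k]
      convert this using 1
      rw [pow_succ']
      group
  obtain ⟨k, hk⟩ := exists_nat_ge (1 / (1 - α * N))
  rw [div_le_iff₀ (by linarith)] at hk
  have hle := hz (k + 1) (x * (Γ.Δ ^ k)⁻¹) (by
    intro i hi
    apply hx'
    have : (i : ℝ) ≤ (k + 1) * N := by exact_mod_cast hi
    have h3 := mul_le_mul_of_nonneg_left this hα0
    nlinarith)
  apply Γ.Δ_inv_not_mem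
  unfold leL at hle
  convert Γ.conjp1 hle k using 1
  rw [pow_succ']
  group

theorem key2 (g : G) (α : ℝ) (hα : α * Γ.norm Γ.Δ < 1) (hα0 : 0 ≤ α) (C : ℕ)
    (hC : ∀ n : ℕ, (Γ.wl (g ^ n) : ℝ) ≤ α * n + C) :
    ∃ y, y⁻¹ * g * y ∈ Γ.P := by
  apply Γ.key g α hα hα0 C
  intro n m h
  have h1 : Γ.wl (g ^ n) ≤ m + C := by
    have := hC n
    have : (Γ.wl (g ^ n) : ℝ) ≤ m + C := by linarith
    exact_mod_cast this
  have h2 := Γ.conjp1 (Γ.lower_mono (Γ.wl_lower (g ^ n)) h1) m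
  unfold leL
  convert h2 using 1
  rw [pow_add]
  group

theorem eq_one_of_conj (g y z : G) (ha : y⁻¹ * g * y ∈ Γ.P) (hb : z⁻¹ * g⁻¹ * z ∈ Γ.P) :
    g = 1 := by
  set w := y⁻¹ * z with hw
  obtain ⟨c, hv⟩ : ∃ c : ℕ, Γ.Δ ^ c * w ∈ Γ.P := ⟨_, Γ.wl_lower w⟩
  set v := Γ.Δ ^ c * w with hvdef
  have ha' := Γ.conjp2 ha c
  set a := Γ.Δ ^ c * (y⁻¹ * g * y) * (Γ.Δ ^ c)⁻¹ with hadef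
  set b := z⁻¹ * g⁻¹ * z with hbdef
  have h1 : a * v * b = v := by
    rw [hadef, hvdef, hbdef, hw]
    group
  have h2 : ∀ n : ℕ, a ^ n * v * b ^ n = v := by
    intro n
    induction n with
    | zero => simp
    | succ n ih =>
      rw [pow_succ, pow_succ', show a ^ n * a * v * (b * b ^ n) = a ^ n * (a * v * b) * b ^ n by
        simp only [mul_assoc], h1, ih]
  have h3 := h2 (Γ.norm v + 1)
  have h4 := Γ.norm_mul (Γ.P.mul_mem (Γ.P.pow_mem ha' (Γ.norm v + 1)) hv)
    (Γ.P.pow_mem hb (Γ.norm v + 1))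
  rw [h3] at h4
  have h5 := Γ.norm_mul (Γ.P.pow_mem ha' (Γ.norm v + 1)) hv
  have h6 := Γ.norm_pow_ge ha' (Γ.norm v + 1)
  have h7 : Γ.norm a = 0 := by
    by_contra h
    have : 1 ≤ Γ.norm a := Nat.one_le_iff_ne_zero.2 h
    nlinarith
  have h8 := Γ.eq_one_of_norm ha' h7
  have h9 : g = y * (Γ.Δ ^ c)⁻¹ * a * Γ.Δ ^ c * y⁻¹ := by
    rw [hadef]; group
  rw [h9, h8]
  group

end GarsideGroup

end helpers

/-- If `g` is a non-identity element of a Garside group, then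
`t_𝒟(g) ≥ 1/N` where `N = ‖Δ‖`. -/
theorem statement1 {G : Type*} [Group G] (Γ : GarsideGroup G) (g : G) (hg : g ≠ 1) :
    ∃ t : ℝ, Filter.Tendsto
        (fun n : ℕ => (wlen (Γ.simples ∪ Γ.simples⁻¹) (g ^ n) : ℝ) / (n : ℝ))
        Filter.atTop (nhds t) ∧ 1 / (Γ.norm Γ.Δ : ℝ) ≤ t := by
  have hsub : Subadditive (fun n : ℕ => (Γ.wl (g ^ n) : ℝ)) := by
    intro m n
    have := Γ.wl_mul (g ^ m) (g ^ n)
    rw [← pow_add] at this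
    beta_reduce
    exact_mod_cast this
  have hlim := hsub.tendsto_lim ⟨0, by rintro _ ⟨n, rfl⟩; positivity⟩
  refine ⟨hsub.lim, hlim, ?_⟩
  by_contra hlt
  push Not at hlt
  obtain ⟨α, hα1, hα2⟩ := exists_between hlt
  have hpos : (0 : ℝ) < Γ.norm Γ.Δ := by exact_mod_cast Γ.norm_Δ_pos
  rw [lt_div_iff₀ hpos] at hα2
  have h0 : 0 ≤ hsub.lim := ge_of_tendsto' hlim (fun n => by positivity)
  obtain ⟨n0, hn0⟩ := eventually_atTop.1 (hlim.eventually (gt_mem_nhds hα1))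
  obtain ⟨C, hC⟩ : ∃ C : ℕ, ∀ n < n0, Γ.wl (g ^ n) ≤ C := by
    refine ⟨∑ n ∈ Finset.range n0, Γ.wl (g ^ n), fun n hn => ?_⟩
    exact Finset.single_le_sum (f := fun n => Γ.wl (g ^ n)) (fun _ _ => Nat.zero_le _)
      (Finset.mem_range.2 hn)
  have hα0 : 0 ≤ α := by linarith
  have hb : ∀ n : ℕ, (Γ.wl (g ^ n) : ℝ) ≤ α * n + (C + Γ.wl (g ^ 0) : ℕ) := by
    intro n
    rcases Nat.eq_zero_or_pos n with rfl | hn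
    · push_cast
      have : (0 : ℝ) ≤ C := by positivity
      simp
    rcases lt_or_ge n n0 with h | h
    · have h1 : (Γ.wl (g ^ n) : ℝ) ≤ C := by exact_mod_cast hC n h
      push_cast
      have : 0 ≤ α * n := by positivity
      have : (0 : ℝ) ≤ Γ.wl (g ^ 0) := by positivity
      linarith
    · have h1 := hn0 n h
      have hn' : (0 : ℝ) < n := by exact_mod_cast hn
      rw [div_lt_iff₀ hn'] at h1
      have : (0 : ℝ) ≤ (C + Γ.wl (g ^ 0) : ℕ) := by positivity
      linarith
  obtain ⟨y, hy⟩ := Γ.key2 g α hα2 hα0 _ hb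
  obtain ⟨z, hz⟩ := Γ.key2 g⁻¹ α hα2 hα0 _ (fun n => by
    refine le_trans ?_ (hb n)
    rw [inv_pow]
    exact_mod_cast Γ.wl_inv_le (g ^ n))
  exact hg (Γ.eq_one_of_conj g y z hy hz)
end

section
/- Let G be a Garside group with Garside element Δ and N = ‖Δ‖. For every element g of G, t_len(g) is a rational number of the form p/q for some integers p, q with 1 ≤ q ≤ N². -/
open Filter Topology Pointwise

namespace GarsideAux

variable {G : Type*} [Group G] (Γ : GarsideGroup G)

lemma le_rfl' (a : G) : leL Γ.P a a := by
  simp [leL, Γ.P.one_mem]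

variable {Γ} in
lemma le_tr {a b c : G} (h : leL Γ.P a b) (h' : leL Γ.P b c) : leL Γ.P a c := by
  have := Γ.P.mul_mem h h'
  simpa [leL, mul_assoc] using this

lemma le_mul (c a b : G) : leL Γ.P (c * a) (c * b) ↔ leL Γ.P a b := by
  simp [leL, mul_assoc]

lemma norm_mul_ge {a b : G} (ha : a ∈ Γ.P) (hb : b ∈ Γ.P) :
    Γ.norm a + Γ.norm b ≤ Γ.norm (a * b) := by
  obtain ⟨l, hl, hl1, hl2⟩ := (Γ.norm_spec a ha).1
  obtain ⟨m, hm, hm1, hm2⟩ := (Γ.norm_spec b hb).1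
  apply (Γ.norm_spec (a * b) (Γ.P.mul_mem ha hb)).2
  refine ⟨l ++ m, by simp [hl, hm], ?_, by simp [hl2, hm2]⟩
  intro x hx
  rcases List.mem_append.1 hx with h | h
  · exact hl1 x h
  · exact hm1 x h

lemma norm_pos {a : G} (ha : a ∈ Γ.P) (h1 : a ≠ 1) : 1 ≤ Γ.norm a := by
  obtain ⟨l, hl, hl1, hl2⟩ := (Γ.norm_spec a ha).1
  by_contra h
  have h0 : l.length = 0 := by omega
  rw [List.length_eq_zero_iff] at h0
  subst h0
  exact h1 (by simpa using hl2.symm)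

variable {Γ} in
lemma le_anti {a b : G} (h : leL Γ.P a b) (h' : leL Γ.P b a) : a = b := by
  by_contra hne
  have h1 : a⁻¹ * b ≠ 1 := by
    intro h; exact hne (by rwa [inv_mul_eq_one] at h)
  have n1 := norm_pos Γ h h1
  have n2 := norm_mul_ge Γ h h'
  have n3 := norm_mul_ge Γ Γ.P.one_mem (Γ.P.mul_mem h h')
  have e : a⁻¹ * b * (b⁻¹ * a) = 1 := by group
  rw [e] at n2 n3
  rw [one_mul] at n3
  omega

lemma conj_mem {a : G} (ha : a ∈ Γ.P) : Γ.Δ⁻¹ * a * Γ.Δ ∈ Γ.P := by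
  have key : Submonoid.closure {a : G | a ∈ Γ.P ∧ leL Γ.P a Γ.Δ} ≤
      Γ.P.comap (MulAut.conj Γ.Δ⁻¹).toMonoidHom := by
    rw [Submonoid.closure_le]
    rintro a ⟨ha, h⟩
    have hb : leR Γ.P (a⁻¹ * Γ.Δ) Γ.Δ := by
      simpa [leR] using ha
    have := (Γ.Δ_balanced _ h).2 hb
    simpa [leL, mul_assoc] using this
  rw [Γ.simples_gen] at key
  simpa using key ha

lemma conj_mem' {a : G} (ha : a ∈ Γ.P) : Γ.Δ * a * Γ.Δ⁻¹ ∈ Γ.P := by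
  have key : Submonoid.closure {a : G | a ∈ Γ.P ∧ leL Γ.P a Γ.Δ} ≤
      Γ.P.comap (MulAut.conj Γ.Δ).toMonoidHom := by
    rw [Submonoid.closure_le]
    rintro a ⟨ha, h⟩
    have h := (Γ.Δ_balanced a ha).1 h
    have hb : leL Γ.P (Γ.Δ * a⁻¹) Γ.Δ := by
      simpa [leL] using ha
    have := (Γ.Δ_balanced _ h).1 hb
    simpa [leR, mul_assoc] using this
  rw [Γ.simples_gen] at key
  simpa using key ha

lemma conj_zpow_mem (i : ℤ) {a : G} (ha : a ∈ Γ.P) :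
    (Γ.Δ ^ i)⁻¹ * a * Γ.Δ ^ i ∈ Γ.P := by
  induction i with
  | zero => simpa using ha
  | succ n ih =>
    have := conj_mem Γ ih
    have e : (Γ.Δ ^ ((n : ℤ) + 1))⁻¹ * a * Γ.Δ ^ ((n : ℤ) + 1)
      = Γ.Δ⁻¹ * ((Γ.Δ ^ (n : ℤ))⁻¹ * a * Γ.Δ ^ (n : ℤ)) * Γ.Δ := by
      rw [zpow_add_one]; group
    rwa [e]
  | pred n ih =>
    have := conj_mem' Γ ih
    have e : (Γ.Δ ^ (-(n : ℤ) - 1))⁻¹ * a * Γ.Δ ^ (-(n : ℤ) - 1)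
      = Γ.Δ * ((Γ.Δ ^ (-(n : ℤ)))⁻¹ * a * Γ.Δ ^ (-(n : ℤ))) * Γ.Δ⁻¹ := by
      rw [zpow_sub_one]; group
    rwa [e]

variable {Γ} in
lemma le_mulΔ {a b : G} (h : leL Γ.P a b) (i : ℤ) :
    leL Γ.P (a * Γ.Δ ^ i) (b * Γ.Δ ^ i) := by
  have := conj_zpow_mem Γ i h
  simpa [leL, mul_assoc] using this

lemma le_Δ {i j : ℤ} (h : i ≤ j) : leL Γ.P (Γ.Δ ^ i) (Γ.Δ ^ j) := by
  obtain ⟨n, rfl⟩ := Int.le.dest h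
  have := Γ.P.pow_mem Γ.Δ_mem n
  simpa [leL, zpow_add] using this

lemma Δ_ne_one : Γ.Δ ≠ 1 := by
  intro h
  have hm : Γ.zinf 1 + 1 ∈ {r : ℤ | leL Γ.P (Γ.Δ ^ r) 1} := by
    simp [h, leL, Γ.P.one_mem]
  have := (Γ.zinf_spec 1).2 hm
  omega

lemma zinf_le (g : G) : leL Γ.P (Γ.Δ ^ Γ.zinf g) g := (Γ.zinf_spec g).1

lemma le_zsup (g : G) : leL Γ.P g (Γ.Δ ^ Γ.zsup g) := (Γ.zsup_spec g).1

/-- binary meets in the group -/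
lemma exists_meet (x y : G) : ∃ z, leL Γ.P z x ∧ leL Γ.P z y ∧
    ∀ d, leL Γ.P d x → leL Γ.P d y → leL Γ.P d z := by
  -- meets relative to a base point
  have base : ∀ u, leL Γ.P u x → leL Γ.P u y → ∃ z, leL Γ.P u z ∧ leL Γ.P z x ∧ leL Γ.P z y ∧
      ∀ d, leL Γ.P u d → leL Γ.P d x → leL Γ.P d y → leL Γ.P d z := by
    intro u hx hy
    obtain ⟨c, hc, h1, h2, h3⟩ := (Γ.latticeL _ hx _ hy).1
    refine ⟨u * c, by simpa [leL] using hc, ?_, ?_, ?_⟩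
    · simpa [leL, mul_assoc] using h1
    · simpa [leL, mul_assoc] using h2
    · intro d hd hdx hdy
      have := h3 (u⁻¹ * d) hd (by simpa [leL, mul_assoc] using hdx)
        (by simpa [leL, mul_assoc] using hdy)
      simpa [leL, mul_assoc] using this
  have lower : ∀ a b : G, ∃ u, leL Γ.P u a ∧ leL Γ.P u b := fun a b =>
    ⟨Γ.Δ ^ (min (Γ.zinf a) (Γ.zinf b)), le_tr (le_Δ Γ (min_le_left _ _)) (zinf_le Γ a),
      le_tr (le_Δ Γ (min_le_right _ _)) (zinf_le Γ b)⟩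
  obtain ⟨u, ux, uy⟩ := lower x y
  obtain ⟨z, uz, zx, zy, hz⟩ := base u ux uy
  refine ⟨z, zx, zy, fun d dx dy => ?_⟩
  obtain ⟨e, eu, ed⟩ := lower u d
  obtain ⟨w, ew, wx, wy, hw⟩ := base e (le_tr eu ux) (le_tr eu uy)
  exact le_tr (hw d ed dx dy) (hz w (hw u eu ux uy) wx wy)

/-- finite meets -/
lemma exists_meet_fin (f : ℕ → G) (n : ℕ) : ∃ z, (∀ j ≤ n, leL Γ.P z (f j)) ∧
    ∀ d, (∀ j ≤ n, leL Γ.P d (f j)) → leL Γ.P d z := by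
  induction n with
  | zero => exact ⟨f 0, by simp [le_rfl'], fun d h => h 0 le_rfl⟩
  | succ n ih =>
    obtain ⟨z, h1, h2⟩ := ih
    obtain ⟨w, wz, wf, hw⟩ := exists_meet Γ z (f (n + 1))
    refine ⟨w, fun j hj => ?_, fun d hd => ?_⟩
    · rcases Nat.lt_or_ge n j with h | h
      · obtain rfl : j = n + 1 := by omega
        exact wf
      · exact le_tr wz (h1 j h)
    · exact hw d (h2 d fun j hj => hd j (by omega)) (hd _ le_rfl)

/-- the chain `Y` -/
lemma exists_Y (g : G) (p : ℤ) (q : ℕ) (hq : 1 ≤ q) (hp : leL Γ.P (Γ.Δ ^ p) (g ^ q)) (k : ℤ) :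
    ∃ z, (∀ (j : ℕ) (i : ℤ), k ≤ i * q + j * p → leL Γ.P z (g ^ j * Γ.Δ ^ i)) ∧
      ∀ d, (∀ (j : ℕ) (i : ℤ), k ≤ i * q + j * p → leL Γ.P d (g ^ j * Γ.Δ ^ i)) →
        leL Γ.P d z := by
  have hq' : (0 : ℤ) < q := by omega
  obtain ⟨z, h1, h2⟩ := exists_meet_fin Γ (fun j => g ^ j * Γ.Δ ^ (-((j * p - k) / q))) q
  refine ⟨z, ?_, fun d hd => h2 d fun j _ => hd j _ ?_⟩
  · intro j
    induction j using Nat.strong_induction_on with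
    | _ j ih =>
      intro i hi
      rcases Nat.lt_or_ge j q with h | h
      · refine le_tr (h1 j h.le) ?_
        rw [le_mul]
        apply le_Δ
        have : -i ≤ (j * p - k) / q := by
          rw [Int.le_ediv_iff_mul_le hq']; linarith
        linarith
      · obtain ⟨m, rfl⟩ := Nat.exists_eq_add_of_le' h
        refine le_tr (ih m (by omega) (p + i) ?_) ?_
        · push_cast at hi; linarith
        · rw [pow_add, mul_assoc, le_mul, zpow_add]
          exact le_mulΔ hp i
  · have := Int.ediv_mul_le (j * p - k) hq'.ne'
    linarith

lemma key (g : G) (p : ℤ) (q : ℕ) (hq : 1 ≤ q) (hp : leL Γ.P (Γ.Δ ^ p) (g ^ q)) :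
    ∃ (a : ℤ) (b : ℕ) (y : G), 1 ≤ b ∧ b ≤ Γ.norm Γ.Δ ∧ b * p ≤ a * q ∧
      leL Γ.P (y * Γ.Δ ^ a) (g ^ b * y) := by
  have hq' : (0 : ℤ) < q := by omega
  choose Y hY1 hY2 using exists_Y Γ g p q hq hp
  have mono : ∀ k l : ℤ, k ≤ l → leL Γ.P (Y k) (Y l) := fun k l h =>
    hY2 l _ fun j i hi => hY1 k j i (h.trans hi)
  have sh : ∀ k m : ℤ, leL Γ.P (Y k * Γ.Δ ^ m) (Y (k + m * q)) := by
    intro k m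
    apply hY2
    intro j i hi
    have := le_mulΔ (hY1 k j (i - m) (by linarith)) m
    rwa [mul_assoc, ← zpow_add, sub_add_cancel] at this
  have shift : ∀ k m : ℤ, Y (k + m * q) = Y k * Γ.Δ ^ m := by
    intro k m
    refine le_anti ?_ (sh k m)
    have h := le_mulΔ (sh (k + m * q) (-m)) m
    rw [mul_assoc, ← zpow_add] at h
    have e : k + m * q + -m * q = k := by ring
    rw [e] at h
    simpa using h
  have hg : ∀ k : ℤ, leL Γ.P (Y (k + p)) (g * Y k) := by
    intro k
    rw [← le_mul Γ g⁻¹, inv_mul_cancel_left]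
    apply hY2
    intro j i hi
    rw [← le_mul Γ g, mul_inv_cancel_left, ← mul_assoc, ← pow_succ']
    apply hY1
    push_cast; linarith
  have next : ∀ k : ℤ, ∃ l : ℤ, k + p ≤ l ∧ leL Γ.P (Y l) (g * Y k) ∧ Y l ≠ Y (l + 1) := by
    intro k
    by_contra! hcon
    have all : ∀ e : ℕ, Y (k + p + e) = Y (k + p) := by
      intro e
      induction e with
      | zero => simp
      | succ e ih =>
        rw [← ih, hcon (k + p + e) (by omega) (by rw [ih]; exact hg k)]
        push_cast; congr 1; ring
    have h1 := all q
    have h2 := shift (k + p) 1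
    rw [one_mul, h1] at h2
    exact Δ_ne_one Γ (by simpa using h2.symm)
  choose φ hφ1 hφ2 hφ3 using next
  let K : ℕ → ℤ := fun n => φ^[n + 1] 0
  have Ksucc : ∀ n, K (n + 1) = φ (K n) := fun n => Function.iterate_succ_apply' φ (n + 1) 0
  have Kjump : ∀ n, Y (K n) ≠ Y (K n + 1) := by
    intro n
    have : K n = φ (φ^[n] 0) := Function.iterate_succ_apply' φ n 0
    rw [this]; exact hφ3 _
  have Kp : ∀ n m : ℕ, K n + m * p ≤ K (n + m) := by
    intro n m
    induction m with
    | zero => simp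
    | succ m ih =>
      have := hφ1 (K (n + m))
      rw [← add_assoc, Ksucc]; push_cast; linarith
  have Kg : ∀ n m : ℕ, leL Γ.P (Y (K (n + m))) (g ^ m * Y (K n)) := by
    intro n m
    induction m with
    | zero => simp [le_rfl']
    | succ m ih =>
      rw [← add_assoc, Ksucc, pow_succ', mul_assoc]
      exact le_tr (hφ2 _) ((le_mul Γ g _ _).2 ih)
  -- pigeonhole
  let ν : ℤ → ℕ := fun r => Γ.norm ((Y 0)⁻¹ * Y r)
  have νadd : ∀ r s : ℤ, 0 ≤ r → r ≤ s → ν r + Γ.norm ((Y r)⁻¹ * Y s) ≤ ν s := by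
    intro r s hr hs
    have := norm_mul_ge Γ (mono 0 r hr) (mono r s hs)
    simpa [ν, mul_assoc] using this
  have νjump : ∀ r : ℤ, 0 ≤ r → Y r ≠ Y (r + 1) → ν r < ν (r + 1) := by
    intro r hr h
    have h1 := νadd r (r + 1) hr (by omega)
    have h2 := norm_pos Γ (mono r (r + 1) (by omega)) (by
      intro h'; exact h (by rwa [inv_mul_eq_one] at h'))
    omega
  have νmono : ∀ r s : ℤ, 0 ≤ r → r ≤ s → ν r ≤ ν s := fun r s hr hs => by
    have := νadd r s hr hs; omega
  have νq : ν q = Γ.norm Γ.Δ := by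
    have := shift 0 1
    simp only [one_mul, zero_add, zpow_one] at this
    simp [ν, this]
  have r0 : ∀ n, 0 ≤ K n % q := fun n => Int.emod_nonneg _ hq'.ne'
  have rq : ∀ n, K n % q < q := fun n => Int.emod_lt_of_pos _ hq'
  have rjump : ∀ n, Y (K n % q) ≠ Y (K n % q + 1) := by
    intro n h
    apply Kjump n
    have e1 := shift (K n % q) (K n / q)
    have e2 := shift (K n % q + 1) (K n / q)
    have d : K n % q + K n / q * q = K n := by rw [mul_comm]; exact Int.emod_add_mul_ediv _ _
    rw [d] at e1
    have d' : K n % q + 1 + K n / q * q = K n + 1 := by linarith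
    rw [d'] at e2
    rw [e1, e2, h]
  have inj : ∀ m n, ν (K m % q) = ν (K n % q) → K m % q = K n % q := by
    have aux : ∀ m n, ν (K m % q) = ν (K n % q) → ¬ K m % q < K n % q := by
      intro m n h hlt
      have h1 := νjump _ (r0 m) (rjump m)
      have h2 := νmono (K m % q + 1) (K n % q) (by have := r0 m; omega) (by omega)
      omega
    intro m n h
    have := aux m n h
    have := aux n m h.symm
    omega
  obtain ⟨m, hm, n, hn, hne, heq⟩ : ∃ m ∈ Finset.range (Γ.norm Γ.Δ + 1),
      ∃ n ∈ Finset.range (Γ.norm Γ.Δ + 1), m ≠ n ∧ ν (K m % q) = ν (K n % q) := by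
    apply Finset.exists_ne_map_eq_of_card_lt_of_maps_to (t := Finset.range (Γ.norm Γ.Δ))
    · simp
    · intro n _
      simp only [Finset.coe_range, Set.mem_Iio]
      have h1 := νjump _ (r0 n) (rjump n)
      have h2 := νmono (K n % q + 1) q (by have := r0 n; omega) (by have := rq n; omega)
      omega
  have fin : ∀ m n : ℕ, m < n → n < Γ.norm Γ.Δ + 1 → ν (K m % q) = ν (K n % q) →
      ∃ (a : ℤ) (b : ℕ) (y : G), 1 ≤ b ∧ b ≤ Γ.norm Γ.Δ ∧ b * p ≤ a * q ∧
      leL Γ.P (y * Γ.Δ ^ a) (g ^ b * y) := by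
    intro m n hmn hn h
    obtain ⟨b, rfl⟩ := Nat.exists_eq_add_of_lt hmn
    have h := inj _ _ h
    obtain ⟨a, ha⟩ := (Int.ModEq.dvd h :
      (q : ℤ) ∣ K (m + b + 1) - K m)
    have h1 := Kp m (b + 1)
    have h2 := Kg m (b + 1)
    rw [← add_assoc] at h1 h2
    have e : K (m + b + 1) = K m + a * q := by linarith
    rw [e, shift] at h2
    rw [e] at h1
    exact ⟨a, b + 1, Y (K m), by omega, by omega, by linarith, h2⟩
  rw [Finset.mem_range] at hm hn
  rcases lt_or_gt_of_ne hne with h | h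
  · exact fin m n h hn heq
  · exact fin n m h hm heq.symm

lemma le_tinf (g : G) (a : ℤ) (b : ℕ) (y : G) (hb : 1 ≤ b)
    (h : leL Γ.P (y * Γ.Δ ^ a) (g ^ b * y)) : (a : ℝ) ≤ b * Γ.tinf g := by
  have it : ∀ n : ℕ, leL Γ.P (y * Γ.Δ ^ (n * a)) (g ^ (b * n) * y) := by
    intro n
    induction n with
    | zero => simp [le_rfl']
    | succ n ih =>
      have h1 := le_mulΔ h (n * a)
      rw [mul_assoc, ← zpow_add, mul_assoc] at h1
      have h2 := (le_mul Γ (g ^ b) _ _).2 ih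
      have e : ((n + 1 : ℕ) : ℤ) * a = a + n * a := by push_cast; ring
      have e' : b * (n + 1) = b + b * n := by ring
      rw [e, e', pow_add, mul_assoc (g ^ b)]
      exact le_tr h1 h2
  set C : ℤ := Γ.zinf y - Γ.zsup y
  have low : ∀ n : ℕ, C + n * a ≤ Γ.zinf (g ^ (b * n)) := by
    intro n
    apply (Γ.zinf_spec _).2
    have h1 := le_mulΔ (zinf_le Γ y) (n * a)
    have h2 := (le_mul Γ (g ^ (b * n)) _ _).2 (le_zsup Γ y)
    have h3 := le_mulΔ (le_tr h1 (le_tr (it n) h2)) (-Γ.zsup y)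
    rw [← zpow_add, ← zpow_add, mul_assoc, ← zpow_add] at h3
    have e : Γ.zinf y + n * a + -Γ.zsup y = C + n * a := by simp only [C]; ring
    rw [e] at h3
    simpa using h3
  have hb' : (0 : ℝ) < b := by exact_mod_cast hb
  have t1 : Tendsto (fun n : ℕ => b * n) atTop atTop :=
    tendsto_id.const_mul_atTop' (by omega)
  have t2 := ((Γ.tinf_spec g).comp t1).const_mul (b : ℝ)
  have t3 : Tendsto (fun n : ℕ => (C : ℝ) / n + a) atTop (𝓝 (0 + a)) :=
    (tendsto_const_div_atTop_nhds_zero_nat _).add_const _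
  rw [zero_add] at t3
  refine le_of_tendsto_of_tendsto t3 t2 ?_
  filter_upwards [eventually_gt_atTop 0] with n hn
  have hn' : (0 : ℝ) < n := by exact_mod_cast hn
  have hl : (C : ℝ) + n * a ≤ Γ.zinf (g ^ (b * n)) := by exact_mod_cast low n
  simp only [Function.comp]
  push_cast
  have e1 : (b : ℝ) * ((Γ.zinf (g ^ (b * n)) : ℝ) / (b * n)) = (Γ.zinf (g ^ (b * n)) : ℝ) / n := by
    field_simp
  have e2 : (C : ℝ) / n + a = (C + n * a) / n := by field_simp
  rw [e1, e2]
  gcongr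

lemma tinf_rat (g : G) : ∃ (a : ℤ) (b : ℕ), 1 ≤ b ∧ b ≤ Γ.norm Γ.Δ ∧
    Γ.tinf g = (a : ℝ) / b := by
  have hN := norm_pos Γ Γ.Δ_mem (Δ_ne_one Γ)
  obtain ⟨b, hb, hmax⟩ := Finset.exists_max_image (Finset.Icc 1 (Γ.norm Γ.Δ))
    (fun b : ℕ => (⌊b * Γ.tinf g⌋ : ℝ) / b) ⟨1, by simp [hN]⟩
  rw [Finset.mem_Icc] at hb
  refine ⟨⌊b * Γ.tinf g⌋, b, hb.1, hb.2, le_antisymm ?_ ?_⟩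
  · refine le_of_tendsto (Γ.tinf_spec g) ?_
    filter_upwards [eventually_ge_atTop 1] with q hq
    obtain ⟨a, c, y, hc, hcN, h1, h2⟩ := key Γ g _ q hq (zinf_le Γ _)
    refine le_trans ?_ (hmax c (Finset.mem_Icc.2 ⟨hc, hcN⟩))
    have h3 : a ≤ ⌊c * Γ.tinf g⌋ := Int.le_floor.2 (le_tinf Γ g a c y hc h2)
    have hq' : (0 : ℝ) < q := by exact_mod_cast hq
    have hc' : (0 : ℝ) < c := by exact_mod_cast hc
    have h1' : (c : ℝ) * Γ.zinf (g ^ q) ≤ a * q := by exact_mod_cast h1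
    have h3' : (a : ℝ) ≤ ⌊c * Γ.tinf g⌋ := by exact_mod_cast h3
    calc (Γ.zinf (g ^ q) : ℝ) / q ≤ a / c := by
          rw [div_le_div_iff₀ hq' hc']; linarith
      _ ≤ _ := by gcongr
  · have hb' : (0 : ℝ) < b := by exact_mod_cast hb.1
    rw [div_le_iff₀ hb', mul_comm]
    exact Int.floor_le _

lemma zsup_eq (g : G) : Γ.zsup g = -Γ.zinf g⁻¹ := by
  have iff : ∀ s : ℤ, leL Γ.P g (Γ.Δ ^ s) ↔ leL Γ.P (Γ.Δ ^ (-s)) g⁻¹ := by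
    intro s
    simp only [leL, zpow_neg, inv_inv]
    constructor
    · intro h
      have := conj_zpow_mem Γ (-s) h
      simpa [mul_assoc] using this
    · intro h
      have := conj_zpow_mem Γ s h
      simpa [mul_assoc] using this
  apply le_antisymm
  · apply (Γ.zsup_spec g).2
    change leL Γ.P g (Γ.Δ ^ (-Γ.zinf g⁻¹))
    rw [iff, neg_neg]
    exact zinf_le Γ _
  · have := (Γ.zinf_spec g⁻¹).2 ((iff _).1 (le_zsup Γ g))
    linarith

lemma tsup_eq (g : G) : Γ.tsup g = -Γ.tinf g⁻¹ := by
  refine tendsto_nhds_unique (Γ.tsup_spec g) ?_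
  convert (Γ.tinf_spec g⁻¹).neg using 2 with n
  rw [zsup_eq, inv_pow]
  push_cast; ring

end GarsideAux

/-- For every `g`, `t_len(g)` is rational of the form `p/q` with
`1 ≤ q ≤ N²`, where `N = ‖Δ‖`. -/
theorem statement3 {G : Type*} [Group G] (Γ : GarsideGroup G) (g : G) :
    ∃ p q : ℤ, 1 ≤ q ∧ q ≤ (Γ.norm Γ.Δ : ℤ) ^ 2 ∧ Γ.tlen g = (p : ℝ) / (q : ℝ) := by
  obtain ⟨a, b, hb, hbN, h⟩ := GarsideAux.tinf_rat Γ g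
  obtain ⟨c, d, hd, hdN, h'⟩ := GarsideAux.tinf_rat Γ g⁻¹
  have hb' : (b : ℝ) ≠ 0 := by have : b ≠ 0 := by omega
                               exact_mod_cast this
  have hd' : (d : ℝ) ≠ 0 := by have : d ≠ 0 := by omega
                               exact_mod_cast this
  refine ⟨-(c * b) - a * d, (b * d : ℕ), ?_, ?_, ?_⟩
  · exact_mod_cast Nat.mul_pos hb hd
  · rw [sq]; exact_mod_cast Nat.mul_le_mul hbN hdN
  · rw [GarsideGroup.tlen, GarsideAux.tsup_eq, h, h']
    push_cast
    field_simp
end
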